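/- Let M_1 and M_2 be admissible n×n matrices, each with at least one positive diagonal, whose Sinkhorn iterations converge to doubly stochastic limits. If M_1 is cross ratio equivalent to M_2, then CI(M_1) = CI(M_2). -/

import Mathlib

open Matrix Filter

/-- A matrix is admissible if it has nonnegative entries and no zero row or column. -/
def Admissible {u v : ℕ} (M : Matrix (Fin u) (Fin v) ℝ) : Prop :=
  (∀ i j, 0 ≤ M i j) ∧ (∀ i, ∃ j, M i j ≠ 0) ∧ (∀ j, ∃ i, M i j ≠ 0)

/-- Row normalization. -/
noncomputable def rowNorm {u v : ℕ} (A : Matrix (Fin u) (Fin v) ℝ) : Matrix (Fin u) (Fin v) ℝ :=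
  Matrix.of fun i j => A i j / ∑ k, A i k

/-- Column normalization. -/
noncomputable def colNorm {u v : ℕ} (A : Matrix (Fin u) (Fin v) ℝ) : Matrix (Fin u) (Fin v) ℝ :=
  Matrix.of fun i j => A i j / ∑ k, A k j

/-- A pair (P,Q) is stable if C(P) = Q and R(Q) = P. -/
def Stable {u v : ℕ} (P Q : Matrix (Fin u) (Fin v) ℝ) : Prop :=
  colNorm P = Q ∧ rowNorm Q = P

/-- The row-normalized Sinkhorn iterates: `skL M 0 = R(M)`, `skL M (k+1) = R(C(skL M k))`. -/
noncomputable def skL {u v : ℕ} (M : Matrix (Fin u) (Fin v) ℝ) : ℕ → Matrix (Fin u) (Fin v) ℝ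
  | 0 => rowNorm M
  | k + 1 => rowNorm (colNorm (skL M k))

/-- The column-normalized Sinkhorn iterates: `skT M k = C(skL M k)`. -/
noncomputable def skT {u v : ℕ} (M : Matrix (Fin u) (Fin v) ℝ) (k : ℕ) : Matrix (Fin u) (Fin v) ℝ :=
  colNorm (skL M k)

/-- Entrywise convergence of a sequence of matrices. -/
def EntrywiseLimit {u v : ℕ} (f : ℕ → Matrix (Fin u) (Fin v) ℝ)
    (L : Matrix (Fin u) (Fin v) ℝ) : Prop :=
  ∀ i j, Filter.Tendsto (fun k => f k i j) Filter.atTop (nhds (L i j))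

/-- `PartialPattern B A` means `B ≺ A` : every zero of `A` is a zero of `B`. -/
def PartialPattern {u v : ℕ} (B A : Matrix (Fin u) (Fin v) ℝ) : Prop :=
  ∀ i j, A i j = 0 → B i j = 0

/-- Product of the diagonal of `A` determined by the permutation `σ`. -/
noncomputable def diagProd {n : ℕ} (A : Matrix (Fin n) (Fin n) ℝ) (σ : Equiv.Perm (Fin n)) : ℝ :=
  ∏ i, A i (σ i)

/-- `A` has at least one positive diagonal. -/
def HasPosDiag {n : ℕ} (A : Matrix (Fin n) (Fin n) ℝ) : Prop :=
  ∃ σ : Equiv.Perm (Fin n), ∀ i, 0 < A i (σ i)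

/-- The entry at position `(i,j)` is contained in some positive diagonal of `A`. -/
def OnDiag {n : ℕ} (A : Matrix (Fin n) (Fin n) ℝ) (i j : Fin n) : Prop :=
  ∃ σ : Equiv.Perm (Fin n), (∀ k, 0 < A k (σ k)) ∧ σ i = j

/-- `A` has total support : every positive entry is on-diagonal. -/
def TotalSupport {n : ℕ} (A : Matrix (Fin n) (Fin n) ℝ) : Prop :=
  ∀ i j, 0 < A i j → OnDiag A i j

/-- Doubly stochastic matrices. -/
def DoublyStochastic {n : ℕ} (A : Matrix (Fin n) (Fin n) ℝ) : Prop :=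
  (∀ i j, 0 ≤ A i j) ∧ (∀ i, ∑ j, A i j = 1) ∧ (∀ j, ∑ i, A i j = 1)

/-- Cross ratio equivalence of square matrices. -/
def CrossRatioEquiv {n : ℕ} (A B : Matrix (Fin n) (Fin n) ℝ) : Prop :=
  (∀ σ : Equiv.Perm (Fin n), diagProd A σ ≠ 0 ↔ diagProd B σ ≠ 0) ∧
  ∀ σ σ' : Equiv.Perm (Fin n), diagProd A σ ≠ 0 → diagProd A σ' ≠ 0 →
    diagProd A σ / diagProd A σ' = diagProd B σ / diagProd B σ'

/-- Diagonal scalings. -/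
def IsScaling {n : ℕ} (M N : Matrix (Fin n) (Fin n) ℝ) : Prop :=
  ∃ r s : Fin n → ℝ, ∀ i j, N i j = r i * s j * M i j

lemma IsScaling.row {n : ℕ} {M N : Matrix (Fin n) (Fin n) ℝ} (h : IsScaling M N) :
    IsScaling M (rowNorm N) := by
  obtain ⟨r, s, h⟩ := h
  refine ⟨fun i => r i / ∑ k, N i k, s, fun i j => ?_⟩
  simp only [rowNorm, Matrix.of_apply]
  rw [h i j]; ring

lemma IsScaling.col {n : ℕ} {M N : Matrix (Fin n) (Fin n) ℝ} (h : IsScaling M N) :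
    IsScaling M (colNorm N) := by
  obtain ⟨r, s, h⟩ := h
  refine ⟨r, fun j => s j / ∑ k, N k j, fun i j => ?_⟩
  simp only [colNorm, Matrix.of_apply]
  rw [h i j]; ring

lemma isScaling_skL {n : ℕ} (M : Matrix (Fin n) (Fin n) ℝ) (k : ℕ) : IsScaling M (skL M k) := by
  induction k with
  | zero => exact IsScaling.row ⟨fun _ => 1, fun _ => 1, fun i j => by simp⟩
  | succ k ih => exact ih.col.row

lemma IsScaling.diag {n : ℕ} {M N : Matrix (Fin n) (Fin n) ℝ} (h : IsScaling M N)
    (σ τ : Equiv.Perm (Fin n)) :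
    diagProd N σ * diagProd M τ = diagProd N τ * diagProd M σ := by
  obtain ⟨r, s, h⟩ := h
  have key : ∀ σ : Equiv.Perm (Fin n), diagProd N σ = (∏ i, r i) * (∏ i, s i) * diagProd M σ := by
    intro σ
    simp only [diagProd, h, Finset.prod_mul_distrib]
    rw [Equiv.prod_comp σ s]
  rw [key σ, key τ]; ring

lemma limit_diag {n : ℕ} {M L : Matrix (Fin n) (Fin n) ℝ} (hL : EntrywiseLimit (skL M) L)
    (σ τ : Equiv.Perm (Fin n)) :
    diagProd L σ * diagProd M τ = diagProd L τ * diagProd M σ := by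
  have ht : ∀ σ : Equiv.Perm (Fin n),
      Tendsto (fun k => diagProd (skL M k) σ) atTop (nhds (diagProd L σ)) := fun σ =>
    tendsto_finsetProd _ fun i _ => hL i (σ i)
  refine tendsto_nhds_unique ((ht σ).mul_const (diagProd M τ)) ?_
  simp_rw [fun k => (isScaling_skL M k).diag σ τ]
  exact (ht τ).mul_const _

/-- Birkhoff decomposition, in a form adapted to linear functionals. -/
lemma birkhoff_sum {n : ℕ} {A : Matrix (Fin n) (Fin n) ℝ} (hA : DoublyStochastic A) :
    ∃ w : Equiv.Perm (Fin n) → ℝ, (∀ σ, 0 ≤ w σ) ∧ ∑ σ, w σ = 1 ∧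
      (∀ f : Fin n → Fin n → ℝ, ∑ i, ∑ j, A i j * f i j = ∑ σ, w σ * ∑ i, f i (σ i)) ∧
      (∀ σ, w σ ≠ 0 → ∀ i, 0 < A i (σ i)) ∧
      (∀ i j, A i j ≠ 0 → ∃ σ, w σ ≠ 0 ∧ σ i = j) := by
  have hm : A ∈ doublyStochastic ℝ (Fin n) := by
    rw [mem_doublyStochastic_iff_sum]; exact hA
  obtain ⟨w, hw0, hw1, hw⟩ := exists_eq_sum_perm_of_mem_doublyStochastic hm
  have hent : ∀ i j, A i j = ∑ σ : Equiv.Perm (Fin n), w σ * (if σ i = j then 1 else 0) := by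
    intro i j
    rw [← hw, Matrix.sum_apply]
    refine Finset.sum_congr rfl fun σ _ => ?_
    simp [Equiv.Perm.permMatrix, PEquiv.toMatrix_apply, eq_comm]
  refine ⟨w, hw0, hw1, ?_, ?_, ?_⟩
  · intro f
    simp_rw [hent, Finset.sum_mul, Finset.mul_sum]
    rw [Finset.sum_comm (s := (Finset.univ : Finset (Equiv.Perm (Fin n))))]
    refine Finset.sum_congr rfl fun i _ => ?_
    rw [Finset.sum_comm]
    refine Finset.sum_congr rfl fun σ _ => ?_
    simp
  · intro σ hσ i
    rw [hent]
    refine Finset.sum_pos' (fun τ _ => mul_nonneg (hw0 τ) (by split_ifs <;> simp)) ⟨σ, Finset.mem_univ _, ?_⟩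
    simpa using lt_of_le_of_ne (hw0 σ) hσ.symm
  · intro i j hij
    rw [hent] at hij
    obtain ⟨σ, _, hσ⟩ := Finset.exists_ne_zero_of_sum_ne_zero hij
    refine ⟨σ, left_ne_zero_of_mul hσ, ?_⟩
    by_contra hne
    simp [hne] at hσ

lemma diagProd_ne_zero_iff {n : ℕ} {A : Matrix (Fin n) (Fin n) ℝ} {σ : Equiv.Perm (Fin n)} :
    diagProd A σ ≠ 0 ↔ ∀ i, A i (σ i) ≠ 0 := by
  simp [diagProd, Finset.prod_ne_zero_iff]

lemma limit_prop {n : ℕ} {M L : Matrix (Fin n) (Fin n) ℝ} (hM : HasPosDiag M)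
    (hD : DoublyStochastic L) (hL : EntrywiseLimit (skL M) L) :
    ∃ c : ℝ, c ≠ 0 ∧ ∀ σ, diagProd L σ = c * diagProd M σ := by
  obtain ⟨τ, hτ⟩ := hM
  have hτ0 : diagProd M τ ≠ 0 := diagProd_ne_zero_iff.2 fun i => (hτ i).ne'
  have key : ∀ σ, diagProd L σ = diagProd L τ / diagProd M τ * diagProd M σ := by
    intro σ
    have := limit_diag hL σ τ
    field_simp
    linarith
  refine ⟨_, ?_, key⟩
  intro hc
  obtain ⟨w, -, hw1, -, hpos, -⟩ := birkhoff_sum hD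
  obtain ⟨σ, _, hσ⟩ := Finset.exists_ne_zero_of_sum_ne_zero (hw1.trans_ne one_ne_zero)
  have := key σ
  rw [hc, zero_mul] at this
  exact diagProd_ne_zero_iff.2 (fun i => (hpos σ hσ i).ne') this

lemma ds_unique {n : ℕ} {A B : Matrix (Fin n) (Fin n) ℝ} (hA : DoublyStochastic A)
    (hB : DoublyStochastic B) (c : ℝ) (hc : c ≠ 0)
    (h : ∀ σ, diagProd A σ = c * diagProd B σ) : A = B := by
  have hiff : ∀ σ, diagProd A σ ≠ 0 ↔ diagProd B σ ≠ 0 := fun σ => by rw [h σ]; simp [hc]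
  obtain ⟨w, hw0, hw1, hwf, hwp, hwe⟩ := birkhoff_sum hA
  obtain ⟨v, hv0, hv1, hvf, hvp, hve⟩ := birkhoff_sum hB
  have hsupp : ∀ i j, A i j ≠ 0 ↔ B i j ≠ 0 := by
    intro i j
    constructor
    · intro hij
      obtain ⟨σ, hσ, rfl⟩ := hwe i j hij
      exact diagProd_ne_zero_iff.1
        ((hiff σ).1 (diagProd_ne_zero_iff.2 fun i => (hwp σ hσ i).ne')) i
    · intro hij
      obtain ⟨σ, hσ, rfl⟩ := hve i j hij
      exact diagProd_ne_zero_iff.1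
        ((hiff σ).2 (diagProd_ne_zero_iff.2 fun i => (hvp σ hσ i).ne')) i
  have hlog : ∀ σ, diagProd A σ ≠ 0 →
      ∑ i, (Real.log (A i (σ i)) - Real.log (B i (σ i))) = Real.log c := by
    intro σ hσ
    have hσB := (hiff σ).1 hσ
    rw [Finset.sum_sub_distrib, ← Real.log_prod (fun i _ => diagProd_ne_zero_iff.1 hσ i),
      ← Real.log_prod (fun i _ => diagProd_ne_zero_iff.1 hσB i)]
    change Real.log (diagProd A σ) - Real.log (diagProd B σ) = _
    rw [h σ, Real.log_mul hc hσB]; ring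
  have hs1 := hwf fun i j => Real.log (A i j) - Real.log (B i j)
  have hs2 := hvf fun i j => Real.log (A i j) - Real.log (B i j)
  have e1 : ∑ σ, w σ * ∑ i, (Real.log (A i (σ i)) - Real.log (B i (σ i))) = Real.log c := by
    rw [← one_mul (Real.log c), ← hw1, Finset.sum_mul]
    refine Finset.sum_congr rfl fun σ _ => ?_
    by_cases hσ : w σ = 0
    · simp [hσ]
    · rw [hlog σ (diagProd_ne_zero_iff.2 fun i => (hwp σ hσ i).ne')]
  have e2 : ∑ σ, v σ * ∑ i, (Real.log (A i (σ i)) - Real.log (B i (σ i))) = Real.log c := by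
    rw [← one_mul (Real.log c), ← hv1, Finset.sum_mul]
    refine Finset.sum_congr rfl fun σ _ => ?_
    by_cases hσ : v σ = 0
    · simp [hσ]
    · rw [hlog σ ((hiff σ).2 (diagProd_ne_zero_iff.2 fun i => (hvp σ hσ i).ne'))]
  have hz : ∑ i, ∑ j, (A i j - B i j) * (Real.log (A i j) - Real.log (B i j)) = 0 := by
    simp_rw [sub_mul (A _ _), Finset.sum_sub_distrib]
    rw [hs1, hs2, e1, e2, sub_self]
  have hterm : ∀ i j, 0 ≤ (A i j - B i j) * (Real.log (A i j) - Real.log (B i j)) ∧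
      ((A i j - B i j) * (Real.log (A i j) - Real.log (B i j)) = 0 → A i j = B i j) := by
    intro i j
    by_cases ha : A i j = 0
    · have hb : B i j = 0 := by
        by_contra hb
        exact (hsupp i j).2 hb ha
      simp [ha, hb]
    · have ha' : 0 < A i j := lt_of_le_of_ne (hA.1 i j) (Ne.symm ha)
      have hb' : 0 < B i j := lt_of_le_of_ne (hB.1 i j) (Ne.symm ((hsupp i j).1 ha))
      rcases lt_trichotomy (A i j) (B i j) with hlt | heq | hlt
      · have := Real.log_lt_log ha' hlt
        have hp := mul_pos_of_neg_of_neg (sub_neg.2 hlt) (sub_neg.2 this)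
        exact ⟨hp.le, fun h0 => absurd h0 hp.ne'⟩
      · simp [heq]
      · have := Real.log_lt_log hb' hlt
        have hp := mul_pos (sub_pos.2 hlt) (sub_pos.2 this)
        exact ⟨hp.le, fun h0 => absurd h0 hp.ne'⟩
  ext i j
  rw [Finset.sum_eq_zero_iff_of_nonneg
    (fun i _ => Finset.sum_nonneg fun j _ => (hterm i j).1)] at hz
  have hz' := hz i (Finset.mem_univ _)
  rw [Finset.sum_eq_zero_iff_of_nonneg (fun j _ => (hterm i j).1)] at hz'
  exact (hterm i j).2 (hz' j (Finset.mem_univ _))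

/-- Cross ratio equivalent admissible matrices (with positive diagonals,
whose Sinkhorn iterations converge to doubly stochastic limits) have the same
cooperative index. -/
theorem crossRatioEquiv_CI_eq (n : ℕ) (M₁ M₂ M₁s M₂s : Matrix (Fin n) (Fin n) ℝ)
    (h1 : Admissible M₁) (h2 : Admissible M₂)
    (hpd1 : HasPosDiag M₁) (hpd2 : HasPosDiag M₂)
    (hDS1 : DoublyStochastic M₁s) (hDS2 : DoublyStochastic M₂s)
    (hL1 : EntrywiseLimit (skL M₁) M₁s) (hT1 : EntrywiseLimit (skT M₁) M₁s)
    (hL2 : EntrywiseLimit (skL M₂) M₂s) (hT2 : EntrywiseLimit (skT M₂) M₂s)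
    (hcr : CrossRatioEquiv M₁ M₂) :
    (1 / (n : ℝ)) * ∑ i, ∑ j, (M₁s i j) ^ 2 =
      (1 / (n : ℝ)) * ∑ i, ∑ j, (M₂s i j) ^ 2 := by
  obtain ⟨c₁, hc₁, hd₁⟩ := limit_prop hpd1 hDS1 hL1
  obtain ⟨c₂, hc₂, hd₂⟩ := limit_prop hpd2 hDS2 hL2
  obtain ⟨τ, hτ⟩ := hpd1
  have hτ1 : diagProd M₁ τ ≠ 0 := diagProd_ne_zero_iff.2 fun i => (hτ i).ne'
  have hτ2 : diagProd M₂ τ ≠ 0 := (hcr.1 τ).1 hτ1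
  have hM : ∀ σ, diagProd M₁ σ = diagProd M₁ τ / diagProd M₂ τ * diagProd M₂ σ := by
    intro σ
    by_cases hσ : diagProd M₁ σ = 0
    · have : diagProd M₂ σ = 0 := by
        by_contra hne
        exact (hcr.1 σ).2 hne hσ
      rw [hσ, this, mul_zero]
    · have := hcr.2 σ τ hσ hτ1
      rw [div_eq_div_iff hτ1 hτ2] at this
      field_simp
      linarith
  have : M₁s = M₂s := by
    refine ds_unique hDS1 hDS2 (c₁ * (diagProd M₁ τ / diagProd M₂ τ) / c₂)
      (div_ne_zero (mul_ne_zero hc₁ (div_ne_zero hτ1 hτ2)) hc₂) fun σ => ?_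
    rw [hd₁, hd₂, hM σ]
    field_simp
  rw [this]
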